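/- For all real numbers c_X, c_Y with 0 < c_X ≤ 1 and 0 < c_Y ≤ 1, the inequality ( 1 + √(2c_Y) + √(2c_X) + c_Y √(2c_X) + c_X √(2c_Y) + 2√(c_X c_Y) ) / ( √(c_X c_Y) · √( 2 + 2c_X + 2c_Y ) ) ≥ (3 + 4√2)/√6 holds, with equality when c_X = c_Y = 1. -/

import Mathlib

theorem power_lower_bound_inequality (cX cY : ℝ)
    (hcX0 : 0 < cX) (hcX1 : cX ≤ 1) (hcY0 : 0 < cY) (hcY1 : cY ≤ 1) :
    (3 + 4 * Real.sqrt 2) / Real.sqrt 6 ≤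
      (1 + Real.sqrt (2 * cY) + Real.sqrt (2 * cX) + cY * Real.sqrt (2 * cX)
          + cX * Real.sqrt (2 * cY) + 2 * Real.sqrt (cX * cY)) /
        (Real.sqrt (cX * cY) * Real.sqrt (2 + 2 * cX + 2 * cY)) ∧
    (cX = 1 → cY = 1 →
      (1 + Real.sqrt (2 * cY) + Real.sqrt (2 * cX) + cY * Real.sqrt (2 * cX)
          + cX * Real.sqrt (2 * cY) + 2 * Real.sqrt (cX * cY)) /
        (Real.sqrt (cX * cY) * Real.sqrt (2 + 2 * cX + 2 * cY)) =
      (3 + 4 * Real.sqrt 2) / Real.sqrt 6) := by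
  constructor
  · have ha : 0 < Real.sqrt cX := Real.sqrt_pos.2 hcX0
    have hb : 0 < Real.sqrt cY := Real.sqrt_pos.2 hcY0
    have hs : 0 < Real.sqrt 2 := Real.sqrt_pos.2 (by norm_num)
    have ha1 : Real.sqrt cX ≤ 1 := Real.sqrt_le_one.2 hcX1
    have hb1 : Real.sqrt cY ≤ 1 := Real.sqrt_le_one.2 hcY1
    have hX : Real.sqrt cX ^ 2 = cX := Real.sq_sqrt hcX0.le
    have hY : Real.sqrt cY ^ 2 = cY := Real.sq_sqrt hcY0.le
    have hd : Real.sqrt (2 + 2 * cX + 2 * cY) ≤ Real.sqrt 6 :=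
      Real.sqrt_le_sqrt (by linarith)
    have hd0 : 0 < Real.sqrt (2 + 2 * cX + 2 * cY) := Real.sqrt_pos.2 (by linarith)
    have h6 : 0 < Real.sqrt 6 := Real.sqrt_pos.2 (by norm_num)
    rw [Real.sqrt_mul (by norm_num) cX, Real.sqrt_mul (by norm_num) cY,
      Real.sqrt_mul hcX0.le cY]
    generalize Real.sqrt (2 + 2 * cX + 2 * cY) = d at *
    generalize Real.sqrt cX = a at *
    generalize Real.sqrt cY = b at *
    generalize Real.sqrt 2 = s at *
    generalize Real.sqrt 6 = r at *
    subst hX hY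
    have hab : a * b ≤ 1 := by nlinarith
    have hkey : 0 ≤ s * (b * (a - 1) ^ 2 + a * (b - 1) ^ 2) := by positivity
    have hN : (3 + 4 * s) * (a * b) ≤ 1 + s * b + s * a + b ^ 2 * (s * a)
        + a ^ 2 * (s * b) + 2 * (a * b) := by nlinarith
    rw [div_le_div_iff₀ h6 (by positivity)]
    calc (3 + 4 * s) * (a * b * d) = ((3 + 4 * s) * (a * b)) * d := by ring
      _ ≤ _ := mul_le_mul hN hd hd0.le (by positivity)
  · rintro rfl rfl
    norm_num
    ring
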